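/- If there is a job j such that x_{j1}·x_{j2} > 0, then B1 = {j} or B2 = {j}. -/

import Mathlib

open Finset

noncomputable section

/-- Feasibility for system `S`. -/
def FeasibleS {J M : Type*} [Fintype J] [Fintype M]
    (G1 G2 : Finset M) (b : J → M → ℕ) (a1 a2 : J → ℕ)
    (y : J → M → ℝ) (x1 x2 : J → ℝ) (r w : ℝ) : Prop :=
  (∀ h ∈ G1, ((∑ j, (b j h : ℝ)) - ((∑ j, (a2 j : ℝ)) - r) ≤ (∑ j, y j h)) ∧
    ((∑ j, y j h) ≤ w)) ∧
  (∀ h ∈ G2, ((∑ j, (b j h : ℝ)) - ((∑ j, (a1 j : ℝ)) - r) ≤ (∑ j, y j h)) ∧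
    ((∑ j, y j h) ≤ w)) ∧
  (∀ j, (∑ h, y j h) ≤ w) ∧
  (∀ j, ∀ h, 0 ≤ y j h ∧ y j h ≤ (b j h : ℝ)) ∧
  ((∑ j, x1 j) = r) ∧ ((∑ j, x2 j) = r) ∧
  (∀ j, x1 j + x2 j ≤ r) ∧
  (∀ j, 0 ≤ x1 j ∧ x1 j ≤ (a1 j : ℝ)) ∧
  (∀ j, 0 ≤ x2 j ∧ x2 j ≤ (a2 j : ℝ)) ∧
  (∀ j, (∑ h ∈ G1, ((b j h : ℝ) - y j h)) + (a2 j : ℝ) - x2 j ≤ (∑ j', (a2 j' : ℝ)) - r) ∧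
  (∀ j, (∑ h ∈ G2, ((b j h : ℝ) - y j h)) + (a1 j : ℝ) - x1 j ≤ (∑ j', (a1 j' : ℝ)) - r)

/-- Feasibility for the linear program `ℓp` associated with an optimal
LP-relaxation value `(rstar, wstar)`. -/
def FeasibleLP {J M : Type*} [Fintype J] [Fintype M]
    (G1 G2 : Finset M) (b : J → M → ℕ) (a1 a2 : J → ℕ)
    (rstar wstar : ℝ)
    (y : J → M → ℝ) (x1 x2 : J → ℝ) (r w : ℝ) : Prop :=
  FeasibleS G1 G2 b a1 a2 y x1 x2 r w ∧
  w - r = (⌈wstar - rstar⌉ : ℝ) ∧ ((⌊rstar⌋ : ℝ) ≤ r)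

/-- A machine-saturating matching inside the support of `y`, covering all full jobs. -/
def Slot {J M : Type*} [Fintype M] (y : J → M → ℝ) (w : ℝ) (A : M → J) : Prop :=
  Function.Injective A ∧ (∀ h, 0 < y (A h) h) ∧ (∀ j, ∑ h, y j h = w → ∃ h, A h = j)

lemma slot_exists {J M : Type*} [Fintype J] [Fintype M] [DecidableEq J] [DecidableEq M]
    (y : J → M → ℝ) (w : ℝ) (hw : 0 < w) (hy : ∀ j h, 0 ≤ y j h)
    (hcol : ∀ h, ∑ j, y j h = w) (hrow : ∀ j, ∑ h, y j h ≤ w)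
    (k : J) (S : Finset M) (hS : ∑ h ∈ S, y k h < w) :
    ∃ A, Slot y w A ∧ ∀ h ∈ S, A h ≠ k := by
  let Q : Matrix (J ⊕ M) (J ⊕ M) ℝ := fun i i' => match i, i' with
    | Sum.inr h, Sum.inl j => y j h / w
    | Sum.inr _, Sum.inr _ => 0
    | Sum.inl j, Sum.inl j' => if j = j' then (w - ∑ h, y j h) / w else 0
    | Sum.inl j, Sum.inr h => y j h / w
  have hQ : Q ∈ doublyStochastic ℝ (J ⊕ M) := by
    rw [mem_doublyStochastic_iff_sum]
    refine ⟨?_, ?_, ?_⟩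
    · rintro (j | h) (j' | h')
      · simp only [Q]
        split_ifs
        · exact div_nonneg (sub_nonneg.2 (hrow j)) hw.le
        · exact le_rfl
      · exact div_nonneg (hy _ _) hw.le
      · exact div_nonneg (hy _ _) hw.le
      · exact le_rfl
    · rintro (j | h)
      · simp only [Fintype.sum_sum_type, Q, Finset.sum_ite_eq, Finset.mem_univ, if_true,
          ← Finset.sum_div]
        field_simp
        ring
      · simp only [Fintype.sum_sum_type, Q, ← Finset.sum_div, hcol]
        field_simp
        simp
    · rintro (j | h)
      · simp only [Fintype.sum_sum_type, Q, Finset.sum_ite_eq', Finset.mem_univ, if_true,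
          ← Finset.sum_div]
        field_simp
        ring
      · simp only [Fintype.sum_sum_type, Q, ← Finset.sum_div, hcol]
        field_simp
        simp
  obtain ⟨c, hc0, hc1, hcQ⟩ := exists_eq_sum_perm_of_mem_doublyStochastic hQ
  have hent : ∀ i i', Q i i' = ∑ σ, c σ * (if σ i = i' then 1 else 0) := by
    intro i i'
    rw [← hcQ, Matrix.sum_apply]
    refine Finset.sum_congr rfl fun σ _ => ?_
    simp [Equiv.Perm.permMatrix, PEquiv.toMatrix_apply, eq_comm]
  have hpos : ∀ σ, 0 < c σ → ∀ i, 0 < Q i (σ i) := by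
    intro σ hσ i
    rw [hent]
    refine Finset.sum_pos' (fun τ _ => mul_nonneg (hc0 τ) (by split_ifs <;> norm_num))
      ⟨σ, Finset.mem_univ _, by simpa using hσ⟩
  have hex : ∃ σ, 0 < c σ ∧ ∀ h ∈ S, σ (Sum.inr h) ≠ Sum.inl k := by
    by_contra! hcon
    have h1 : (∑ h ∈ S, y k h) / w = ∑ σ, c σ * ∑ h ∈ S,
        (if σ (Sum.inr h) = Sum.inl k then (1:ℝ) else 0) := by
      rw [Finset.sum_div]
      have : ∀ h ∈ S, y k h / w = ∑ σ, c σ * (if σ (Sum.inr h) = Sum.inl k then (1:ℝ) else 0) :=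
        fun h _ => hent (Sum.inr h) (Sum.inl k)
      rw [Finset.sum_congr rfl this, Finset.sum_comm]
      exact Finset.sum_congr rfl fun σ _ => by rw [Finset.mul_sum]
    have h2 : ∑ σ, c σ ≤ ∑ σ, c σ * ∑ h ∈ S,
        (if σ (Sum.inr h) = Sum.inl k then (1:ℝ) else 0) := by
      refine Finset.sum_le_sum fun σ _ => ?_
      rcases (hc0 σ).eq_or_lt with h0 | h0
      · simp [← h0]
      · obtain ⟨h, hS', hh⟩ := hcon σ h0
        have : (1:ℝ) ≤ ∑ h ∈ S, (if σ (Sum.inr h) = Sum.inl k then (1:ℝ) else 0) := by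
          have := Finset.single_le_sum
            (f := fun h => (if σ (Sum.inr h) = Sum.inl k then (1:ℝ) else 0))
            (fun i _ => by split_ifs <;> norm_num) hS'
          simpa [hh] using this
        nlinarith
    rw [← h1, hc1, le_div_iff₀ hw] at h2
    linarith
  obtain ⟨σ, hσ, hσS⟩ := hex
  have hA : ∀ h, ∃ j, σ (Sum.inr h) = Sum.inl j := by
    intro h
    have := hpos σ hσ (Sum.inr h)
    rcases hh : σ (Sum.inr h) with j | h'
    · exact ⟨j, rfl⟩
    · rw [hh] at this
      simp [Q] at this
  choose A hA using hA
  refine ⟨A, ⟨?_, ?_, ?_⟩, ?_⟩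
  · intro h h' e
    have : σ (Sum.inr h) = σ (Sum.inr h') := by rw [hA, hA, e]
    simpa using σ.injective this
  · intro h
    have := hpos σ hσ (Sum.inr h)
    rw [hA] at this
    simp only [Q] at this
    exact (div_pos_iff_of_pos_right hw).1 this
  · intro j hj
    obtain ⟨i, hi⟩ := σ.surjective (Sum.inl j)
    rcases i with j' | h
    · exfalso
      have := hpos σ hσ (Sum.inl j')
      rw [hi] at this
      simp only [Q] at this
      split_ifs at this with e
      · subst e
        simp [hj] at this
      · exact lt_irrefl _ this
    · rw [hA] at hi
      exact ⟨h, by simpa using hi⟩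
  · intro h hh e
    exact hσS h hh (by rw [hA, e])

/-- No improving direction. -/
def NoImp {J M : Type*} [Fintype J] [Fintype M] (G1 G2 : Finset M)
    (y : J → M → ℝ) (u v : J → ℝ) (r w : ℝ) (T1 T2 : J → Prop) : Prop :=
  ∀ (z : J → M → ℝ) (d1 d2 : J → ℝ) (N : ℝ), 0 < N →
    (∀ j h, 0 ≤ z j h) → (∀ j h, 0 < z j h → 0 < y j h) →
    (∀ j, 0 ≤ d1 j) → (∀ j, 0 < d1 j → 0 < u j) →
    (∀ j, 0 ≤ d2 j) → (∀ j, 0 < d2 j → 0 < v j) →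
    (∀ h, ∑ j, z j h = N) → ∑ j, d1 j = N → ∑ j, d2 j = N →
    (∀ j, ∑ h, y j h = w → N ≤ ∑ h, z j h) →
    (∀ j, u j + v j = r → N ≤ d1 j + d2 j) →
    (∀ j, T1 j → ∑ h ∈ G2, z j h + d1 j ≤ N) →
    (∀ j, T2 j → ∑ h ∈ G1, z j h + d2 j ≤ N) → False

lemma NoImp.swap {J M : Type*} [Fintype J] [Fintype M] {G1 G2 : Finset M}
    {y : J → M → ℝ} {u v : J → ℝ} {r w : ℝ} {T1 T2 : J → Prop}
    (H : NoImp G1 G2 y u v r w T1 T2) : NoImp G2 G1 y v u r w T2 T1 := by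
  intro z d1 d2 N hN h1 h2 h3 h4 h5 h6 h7 h8 h9 h10 h11 h12 h13
  exact H z d2 d1 N hN h1 h2 h5 h6 h3 h4 h7 h9 h8 h10
    (fun j hj => by rw [add_comm]; exact h11 j (by rw [add_comm]; exact hj)) h13 h12

open Filter Topology in
lemma ev_le (A B s t : ℝ) (h : A ≤ B) (hs : A = B → s ≤ t) :
    ∀ᶠ δ : ℝ in 𝓝[>] 0, A + δ * s ≤ B + δ * t := by
  rcases h.eq_or_lt with e | e
  · filter_upwards [self_mem_nhdsWithin] with δ hδ
    have := mul_le_mul_of_nonneg_left (hs e) (le_of_lt hδ)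
    linarith
  · have hc : ContinuousAt (fun δ : ℝ => B + δ * t - (A + δ * s)) 0 := by fun_prop
    have := hc.eventually (lt_mem_nhds (a := 0) (by simpa using e))
    filter_upwards [nhdsWithin_le_nhds this] with δ hδ
    linarith

open Filter Topology in
lemma noImp_of_opt {J M : Type*} [Fintype J] [Fintype M] [DecidableEq J] [DecidableEq M]
    (G1 G2 : Finset M)
    (b : J → M → ℕ) (a1 a2 : J → ℕ) (rstar wstar : ℝ)
    (y : J → M → ℝ) (x1 x2 : J → ℝ) (r w : ℝ)
    (hfeas : FeasibleLP G1 G2 b a1 a2 rstar wstar y x1 x2 r w)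
    (hopt : ∀ y' x1' x2' r' w',
      FeasibleLP G1 G2 b a1 a2 rstar wstar y' x1' x2' r' w' → r ≤ r')
    (hlt : (⌊rstar⌋ : ℝ) < r)
    (hsat1 : ∀ h ∈ G1, ((∑ j, y j h) = w) ∧
      (w = (∑ j, (b j h : ℝ)) - ((∑ j, (a2 j : ℝ)) - r)))
    (hsat2 : ∀ h ∈ G2, ((∑ j, y j h) = w) ∧
      (w = (∑ j, (b j h : ℝ)) - ((∑ j, (a1 j : ℝ)) - r))) :
    NoImp G1 G2 y x1 x2 r w
      (fun j => (∑ h ∈ G2, ((b j h : ℝ) - y j h)) + (a1 j : ℝ) - x1 j = (∑ j', (a1 j' : ℝ)) - r)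
      (fun j => (∑ h ∈ G1, ((b j h : ℝ) - y j h)) + (a2 j : ℝ) - x2 j
        = (∑ j', (a2 j' : ℝ)) - r) := by
  intro z d1 d2 N hN hz0 hzy hd1 hd1u hd2 hd2v hzc hs1 hs2 hrow hx hT1 hT2
  obtain ⟨⟨-, -, f3, f4, f5, f6, f7, f8, f9, f10, f11⟩, f12, f13⟩ := hfeas
  have key : ∀ᶠ δ : ℝ in 𝓝[>] 0, 0 < δ ∧
      (⌊rstar⌋ : ℝ) + δ * N ≤ r + δ * 0 ∧
      (∀ j, (∑ h, y j h) + δ * N ≤ w + δ * ∑ h, z j h) ∧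
      (∀ j h, 0 + δ * z j h ≤ y j h + δ * 0) ∧
      (∀ j, x1 j + x2 j + δ * N ≤ r + δ * (d1 j + d2 j)) ∧
      (∀ j, 0 + δ * d1 j ≤ x1 j + δ * 0) ∧
      (∀ j, 0 + δ * d2 j ≤ x2 j + δ * 0) ∧
      (∀ j, (∑ h ∈ G1, ((b j h : ℝ) - y j h)) + (a2 j : ℝ) - x2 j +
        δ * (∑ h ∈ G1, z j h + d2 j) ≤ (∑ j', (a2 j' : ℝ)) - r + δ * N) ∧
      (∀ j, (∑ h ∈ G2, ((b j h : ℝ) - y j h)) + (a1 j : ℝ) - x1 j +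
        δ * (∑ h ∈ G2, z j h + d1 j) ≤ (∑ j', (a1 j' : ℝ)) - r + δ * N) := by
    have hsupp : ∀ p q : ℝ, 0 ≤ p → (0 < p → 0 < q) → 0 = q → p ≤ 0 := by
      intro p q h1 h2 h3
      by_contra h4
      have := h2 (not_le.1 h4)
      linarith
    refine (show ∀ᶠ δ : ℝ in 𝓝[>] 0, 0 < δ from self_mem_nhdsWithin).and ?_
    refine (ev_le _ _ _ _ hlt.le (fun e => absurd e hlt.ne)).and ?_
    refine (eventually_all.2 fun j => ev_le _ _ _ _ (f3 j) (hrow j)).and ?_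
    refine (eventually_all.2 fun j => eventually_all.2 fun h =>
      ev_le _ _ _ _ (f4 j h).1 (hsupp _ _ (hz0 j h) (hzy j h))).and ?_
    refine (eventually_all.2 fun j => ev_le _ _ _ _ (f7 j) (hx j)).and ?_
    refine (eventually_all.2 fun j =>
      ev_le _ _ _ _ (f8 j).1 (hsupp _ _ (hd1 j) (hd1u j))).and ?_
    refine (eventually_all.2 fun j =>
      ev_le _ _ _ _ (f9 j).1 (hsupp _ _ (hd2 j) (hd2v j))).and ?_
    refine (eventually_all.2 fun j => ev_le _ _ _ _ (f10 j) (hT2 j)).and ?_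
    exact (eventually_all.2 fun j => ev_le _ _ _ _ (f11 j) (hT1 j))
  obtain ⟨δ, hδ, k1, k2, k3, k4, k5, k6, k7, k8⟩ := key.exists
  have hδN : 0 < δ * N := mul_pos hδ hN
  have hycol : ∀ h, ∑ j, (y j h - δ * z j h) = ∑ j, y j h - δ * N := by
    intro h
    rw [Finset.sum_sub_distrib, ← Finset.mul_sum, hzc]
  have hb : ∀ (S : Finset M) (j : J), ∑ h ∈ S, ((b j h : ℝ) - (y j h - δ * z j h)) =
      ∑ h ∈ S, ((b j h : ℝ) - y j h) + δ * ∑ h ∈ S, z j h := by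
    intro S j
    rw [Finset.mul_sum, ← Finset.sum_add_distrib]
    exact Finset.sum_congr rfl fun h _ => by ring
  have := hopt (fun j h => y j h - δ * z j h) (fun j => x1 j - δ * d1 j)
    (fun j => x2 j - δ * d2 j) (r - δ * N) (w - δ * N)
    ⟨⟨?_, ?_, ?_, ?_, ?_, ?_, ?_, ?_, ?_, ?_, ?_⟩, ?_, ?_⟩
  · linarith
  · intro h hh
    have := hsat1 h hh
    rw [hycol]
    constructor <;> linarith
  · intro h hh
    have := hsat2 h hh
    rw [hycol]
    constructor <;> linarith
  · intro j
    rw [Finset.sum_sub_distrib, ← Finset.mul_sum]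
    linarith [k2 j]
  · intro j h
    have := mul_nonneg hδ.le (hz0 j h)
    constructor <;> linarith [k3 j h, (f4 j h).2]
  · rw [Finset.sum_sub_distrib, ← Finset.mul_sum, hs1, f5]
  · rw [Finset.sum_sub_distrib, ← Finset.mul_sum, hs2, f6]
  · intro j
    linarith [k4 j]
  · intro j
    have := mul_nonneg hδ.le (hd1 j)
    constructor <;> linarith [k5 j, (f8 j).2]
  · intro j
    have := mul_nonneg hδ.le (hd2 j)
    constructor <;> linarith [k6 j, (f9 j).2]
  · intro j
    rw [hb]
    linarith [k7 j]
  · intro j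
    rw [hb]
    linarith [k8 j]
  · linarith
  · linarith

/-- Indicator of a slot. -/
def ind {J M : Type*} [DecidableEq J] (A : M → J) (j : J) (h : M) : ℝ := if A h = j then 1 else 0

lemma ind_nonneg {J M : Type*} [DecidableEq J] (A : M → J) (j : J) (h : M) : 0 ≤ ind A j h := by
  unfold ind; split_ifs <;> norm_num

lemma ind_sum_le {J M : Type*} [DecidableEq J] (A : M → J) (hA : Function.Injective A)
    (S : Finset M) (j : J) : ∑ h ∈ S, ind A j h ≤ 1 := by
  classical
  by_cases hj : ∃ h, A h = j
  · obtain ⟨h0, rfl⟩ := hj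
    have : ∀ h ∈ S, ind A (A h0) h = if h = h0 then 1 else 0 := by
      intro h _
      simp [ind, hA.eq_iff]
    rw [Finset.sum_congr rfl this, Finset.sum_ite_eq']
    split_ifs <;> norm_num
  · push Not at hj
    simp [ind, hj]

lemma ind_sum_zero {J M : Type*} [DecidableEq J] (A : M → J)
    (S : Finset M) (j : J) (h : ∀ h ∈ S, A h ≠ j) : ∑ h ∈ S, ind A j h = 0 :=
  Finset.sum_eq_zero fun i hi => by simp [ind, h i hi]

lemma ind_sum_ge {J M : Type*} [DecidableEq J] [Fintype M] (A : M → J)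
    (j : J) (h : ∃ h, A h = j) : 1 ≤ ∑ h, ind A j h := by
  obtain ⟨h, hh⟩ := h
  have := Finset.single_le_sum (f := ind A j) (fun i _ => ind_nonneg A j i) (Finset.mem_univ h)
  simpa [ind, hh] using this

lemma ind_col {J M : Type*} [DecidableEq J] [Fintype J] (A : M → J) (h : M) :
    ∑ j, ind A j h = 1 := by
  simp [ind]

section core
variable {J M : Type*} [Fintype J] [Fintype M] [DecidableEq J] [DecidableEq M] {G1 G2 : Finset M}
    {y : J → M → ℝ} {u v : J → ℝ} {r w : ℝ} {T1 T2 : J → Prop}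

lemma single_ex (H : NoImp G1 G2 y u v r w T1 T2) (A : M → J) (hA : Slot y w A)
    (a c : J) (ha : 0 < u a) (hc : 0 < v c)
    (ht : ∀ t, u t + v t = r → t = a ∨ t = c)
    (h1 : T1 a → ∀ h ∈ G2, A h ≠ a) (h2 : T2 c → ∀ h ∈ G1, A h ≠ c) : False := by
  obtain ⟨hA1, hA2, hA3⟩ := hA
  refine H (ind A) (fun j => if j = a then 1 else 0) (fun j => if j = c then 1 else 0) 1 one_pos
    (ind_nonneg A) ?_ ?_ ?_ ?_ ?_ (ind_col A) (by simp) (by simp) ?_ ?_ ?_ ?_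
  · intro j h hp
    by_cases e : A h = j
    · rw [← e]; exact hA2 h
    · simp [ind, e] at hp
  · intro j; split_ifs <;> norm_num
  · intro j hj
    by_cases e : j = a
    · rw [e]; exact ha
    · simp [e] at hj
  · intro j; split_ifs <;> norm_num
  · intro j hj
    by_cases e : j = c
    · rw [e]; exact hc
    · simp [e] at hj
  · intro j hj
    exact ind_sum_ge A j (hA3 j hj)
  · intro j hj
    rcases ht j hj with e | e
    · simp only [e, if_true]; split_ifs <;> norm_num
    · simp only [e, if_true]; split_ifs <;> norm_num
  · intro j hj
    by_cases e : j = a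
    · subst e
      rw [ind_sum_zero A G2 j (h1 hj)]; simp
    · simpa [e] using ind_sum_le A hA1 G2 j
  · intro j hj
    by_cases e : j = c
    · subst e
      rw [ind_sum_zero A G1 j (h2 hj)]; simp
    · simpa [e] using ind_sum_le A hA1 G1 j

lemma double_ex (H : NoImp G1 G2 y u v r w T1 T2) (A B : M → J) (hA : Slot y w A)
    (hB : Slot y w B)
    (c k l : J) (hkc : k ≠ c) (hlc : l ≠ c)
    (huc : 0 < u c) (hvc : 0 < v c) (huk : 0 < u k) (hvl : 0 < v l)
    (ht : ∀ t, t ≠ c → u t + v t = r → t = k ∧ t = l)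
    (h1 : T1 k → ∀ h ∈ G2, A h ≠ k) (h2 : T2 l → ∀ h ∈ G1, B h ≠ l)
    (h3 : ∀ h ∈ G2, A h ≠ c) (h4 : ∀ h ∈ G1, B h ≠ c) : False := by
  obtain ⟨hA1, hA2, hA3⟩ := hA
  obtain ⟨hB1, hB2, hB3⟩ := hB
  have hnn : ∀ p q j : J, (0:ℝ) ≤ (if j = p then 1 else 0) + (if j = q then 1 else 0) := by
    intro p q j; split_ifs <;> norm_num
  refine H (fun j h => ind A j h + ind B j h)
    (fun j => (if j = c then 1 else 0) + (if j = k then 1 else 0))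
    (fun j => (if j = c then 1 else 0) + (if j = l then 1 else 0)) 2 two_pos
    (fun j h => add_nonneg (ind_nonneg A j h) (ind_nonneg B j h)) ?_ (hnn c k) ?_ (hnn c l) ?_ ?_
    ?_ ?_ ?_ ?_ ?_ ?_
  · intro j h hp
    by_cases e : A h = j
    · rw [← e]; exact hA2 h
    · by_cases e' : B h = j
      · rw [← e']; exact hB2 h
      · simp [ind, e, e'] at hp
  · intro j hj
    by_cases e : j = c
    · rw [e]; exact huc
    · by_cases e' : j = k
      · rw [e']; exact huk
      · simp [e, e'] at hj
  · intro j hj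
    by_cases e : j = c
    · rw [e]; exact hvc
    · by_cases e' : j = l
      · rw [e']; exact hvl
      · simp [e, e'] at hj
  · intro h
    rw [Finset.sum_add_distrib, ind_col, ind_col]; norm_num
  · rw [Finset.sum_add_distrib]; simp; norm_num
  · rw [Finset.sum_add_distrib]; simp; norm_num
  · intro j hj
    rw [Finset.sum_add_distrib]
    linarith [ind_sum_ge A j (hA3 j hj), ind_sum_ge B j (hB3 j hj)]
  · intro j hj
    by_cases e : j = c
    · simp only [e, if_true]; split_ifs <;> norm_num
    · obtain ⟨e1, e2⟩ := ht j e hj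
      simp only [if_neg e, if_pos e1, if_pos e2]; norm_num
  · intro j hj
    rw [Finset.sum_add_distrib]
    have hBle := ind_sum_le B hB1 G2 j
    have hAle := ind_sum_le A hA1 G2 j
    by_cases e : j = c
    · have := ind_sum_zero A G2 j (by rw [e]; exact h3)
      have e' : j ≠ k := by rw [e]; exact hkc.symm
      simp only [if_pos e, if_neg e']
      linarith
    · by_cases e' : j = k
      · have := ind_sum_zero A G2 j (by rw [e']; exact h1 (e' ▸ hj))
        simp only [if_neg e, if_pos e']
        linarith
      · simp only [if_neg e, if_neg e']
        linarith
  · intro j hj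
    rw [Finset.sum_add_distrib]
    have hBle := ind_sum_le B hB1 G1 j
    have hAle := ind_sum_le A hA1 G1 j
    by_cases e : j = c
    · have := ind_sum_zero B G1 j (by rw [e]; exact h4)
      have e' : j ≠ l := by rw [e]; exact hlc.symm
      simp only [if_pos e, if_neg e']
      linarith
    · by_cases e' : j = l
      · have := ind_sum_zero B G1 j (by rw [e']; exact h2 (e' ▸ hj))
        simp only [if_neg e, if_pos e']
        linarith
      · simp only [if_neg e, if_neg e']
        linarith

lemma avoid (hw : 0 < w) (hy : ∀ j h, 0 ≤ y j h)
    (hcol : ∀ h, ∑ j, y j h = w) (hrow : ∀ j, ∑ h, y j h ≤ w) (T : J → Prop) (G : Finset M) (k : J)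
    (hk : ¬ (T k ∧ ∑ h ∈ G, y k h = w)) :
    ∃ A, Slot y w A ∧ (T k → ∀ h ∈ G, A h ≠ k) := by
  by_cases hT : T k
  · have hle : ∑ h ∈ G, y k h ≤ w :=
      (Finset.sum_le_sum_of_subset_of_nonneg (Finset.subset_univ G) fun i _ _ => hy k i).trans
        (hrow k)
    have hlt : ∑ h ∈ G, y k h < w := lt_of_le_of_ne hle fun e => hk ⟨hT, e⟩
    obtain ⟨A, hA, hA'⟩ := slot_exists y w hw hy hcol hrow k G hlt
    exact ⟨A, hA, fun _ => hA'⟩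
  · obtain ⟨A, hA, -⟩ := slot_exists y w hw hy hcol hrow k ∅ (by simpa using hw)
    exact ⟨A, hA, fun h => absurd h hT⟩

lemma dichotomy (hdisj : Disjoint G1 G2) (H : NoImp G1 G2 y u v r w T1 T2)
    (hw : 0 < w) (hy : ∀ j h, 0 ≤ y j h)
    (hcol : ∀ h, ∑ j, y j h = w) (hrow : ∀ j, ∑ h, y j h ≤ w)
    (c : J) (huc : 0 < u c) (hvc : 0 < v c)
    (ht : ∀ t, t ≠ c → u t + v t = r → ∀ k, k ≠ c → (0 < u k ∨ 0 < v k) → t = k) :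
    (∀ k, k ≠ c → 0 < u k → T1 k ∧ ∑ h ∈ G2, y k h = w) ∨
    (∀ k, k ≠ c → 0 < v k → T2 k ∧ ∑ h ∈ G1, y k h = w) := by
  by_contra! hcon
  obtain ⟨⟨k, hkc, huk, hk⟩, ⟨l, hlc, hvl, hl⟩⟩ := hcon
  obtain ⟨A, hA, hA'⟩ := avoid hw hy hcol hrow T1 G2 k (fun h => hk h.1 h.2)
  obtain ⟨B, hB, hB'⟩ := avoid hw hy hcol hrow T2 G1 l (fun h => hl h.1 h.2)
  have hA1 : ∃ h ∈ G1, A h = c := by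
    by_contra! hno
    exact single_ex H A hA k c huk hvc
      (fun t h => by
        by_cases e : t = c
        · exact Or.inr e
        · exact Or.inl (ht t e h k hkc (Or.inl huk))) hA' (fun _ => hno)
  have hB1 : ∃ h ∈ G2, B h = c := by
    by_contra! hno
    exact single_ex H B hB c l huc hvl
      (fun t h => by
        by_cases e : t = c
        · exact Or.inl e
        · exact Or.inr (ht t e h l hlc (Or.inr hvl))) (fun _ => hno) hB'
  obtain ⟨g, hg, hgc⟩ := hA1
  obtain ⟨g', hg', hgc'⟩ := hB1
  refine double_ex H A B hA hB c k l hkc hlc huc hvc huk hvl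
    (fun t e h => ⟨ht t e h k hkc (Or.inl huk), ht t e h l hlc (Or.inr hvl)⟩) hA' hB' ?_ ?_
  · intro h hh e
    have : h = g := hA.1 (e.trans hgc.symm)
    exact Finset.disjoint_left.1 hdisj hg (this ▸ hh)
  · intro h hh e
    have : h = g' := hB.1 (e.trans hgc'.symm)
    exact Finset.disjoint_left.1 hdisj hh (this ▸ hg')

lemma center_too (hdisj : Disjoint G1 G2) (H : NoImp G1 G2 y u v r w T1 T2)
    (hw : 0 < w) (hy : ∀ j h, 0 ≤ y j h)
    (hcol : ∀ h, ∑ j, y j h = w) (hrow : ∀ j, ∑ h, y j h ≤ w)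
    (c j : J) (hjc : j ≠ c) (huc : 0 < u c) (huj : 0 < u j) (hvj : 0 < v j)
    (ht : ∀ t, t ≠ c → u t + v t = r → ∀ k, k ≠ c → (0 < u k ∨ 0 < v k) → t = k)
    (hall : ∀ k, k ≠ c → 0 < u k → T1 k ∧ ∑ h ∈ G2, y k h = w) :
    ∀ k, 0 < u k → T1 k ∧ ∑ h ∈ G2, y k h = w := by
  intro k huk
  by_cases hkc : k = c
  swap
  · exact hall k hkc huk
  subst hkc
  by_contra hk
  obtain ⟨A, hA, hA'⟩ := avoid hw hy hcol hrow T1 G2 k hk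
  refine single_ex H A hA k j huk hvj ?_ hA' ?_
  · intro t h
    by_cases e : t = k
    · exact Or.inl e
    · exact Or.inr (ht t e h j hjc (Or.inl huj))
  · intro _ h hh e
    have hp := hA.2.1 h
    rw [e] at hp
    have hq := (hall j hjc huj).2
    have h1 : y j h ≤ ∑ h ∈ G1, y j h :=
      Finset.single_le_sum (f := y j) (fun i _ => hy j i) hh
    have h2 : ∑ h ∈ G1, y j h + ∑ h ∈ G2, y j h ≤ ∑ h, y j h := by
      rw [← Finset.sum_union hdisj]
      exact Finset.sum_le_sum_of_subset_of_nonneg (Finset.subset_univ _) fun i _ _ => hy j i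
    linarith [hrow j]

end core

lemma int_of_tight {M : Type*} (G : Finset M) (b : M → ℕ) (a : ℕ) (D : ℕ) (y : M → ℝ)
    (x r w : ℝ) (K : ℤ) (hK : w - r = K)
    (h : (∑ h ∈ G, ((b h : ℝ) - y h)) + (a : ℝ) - x = (D : ℝ) - r ∧ ∑ h ∈ G, y h = w) :
    ∃ z : ℤ, x = (z : ℝ) := by
  obtain ⟨h1, h2⟩ := h
  refine ⟨(∑ h ∈ G, (b h : ℤ)) + a - D - K, ?_⟩
  rw [Finset.sum_sub_distrib, h2] at h1
  push_cast
  linarith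

lemma int_sum {J : Type*} [Fintype J] (u : J → ℝ) (h : ∀ j, ∃ z : ℤ, u j = (z : ℝ)) :
    ∃ z : ℤ, ∑ j, u j = (z : ℝ) := by
  choose f hf using h
  exact ⟨∑ j, f j, by push_cast; exact Finset.sum_congr rfl fun j _ => hf j⟩

theorem product_positive_implies_singleton
    {J M : Type*} [Fintype J] [Fintype M] [DecidableEq J] [DecidableEq M]
    (G1 G2 : Finset M) (hG1ne : G1.Nonempty) (hG2ne : G2.Nonempty)
    (hdisj : Disjoint G1 G2) (hcover : G1 ∪ G2 = Finset.univ)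
    (b : J → M → ℕ) (a1 a2 : J → ℕ)
    (ystar : J → M → ℝ) (x1star x2star : J → ℝ) (rstar wstar : ℝ)
    (hstar : FeasibleS G1 G2 b a1 a2 ystar x1star x2star rstar wstar)
    (hstaropt : ∀ y' x1' x2' r' w', FeasibleS G1 G2 b a1 a2 y' x1' x2' r' w' →
      wstar - rstar ≤ w' - r')
    (y : J → M → ℝ) (x1 x2 : J → ℝ) (r w : ℝ)
    (hfeas : FeasibleLP G1 G2 b a1 a2 rstar wstar y x1 x2 r w)
    (hopt : ∀ y' x1' x2' r' w',
      FeasibleLP G1 G2 b a1 a2 rstar wstar y' x1' x2' r' w' → r ≤ r')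
    (ε : ℝ) (hε0 : 0 < ε) (hε1 : ε < 1) (hrε : r = (⌊rstar⌋ : ℝ) + ε)
    (hsat1 : ∀ h ∈ G1, ((∑ j, y j h) = w) ∧
      (w = (∑ j, (b j h : ℝ)) - ((∑ j, (a2 j : ℝ)) - r)))
    (hsat2 : ∀ h ∈ G2, ((∑ j, y j h) = w) ∧
      (w = (∑ j, (b j h : ℝ)) - ((∑ j, (a1 j : ℝ)) - r)))
    (B1 B2 : Finset J)
    (hB1 : ∀ j, j ∈ B1 ↔ ¬∃ z : ℤ, x1 j = (z : ℝ))
    (hB2 : ∀ j, j ∈ B2 ↔ ¬∃ z : ℤ, x2 j = (z : ℝ))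
    :
    ∀ j, 0 < x1 j * x2 j → B1 = {j} ∨ B2 = {j} := by
  intro j hj
  have hlt : (⌊rstar⌋ : ℝ) < r := by linarith
  have H := noImp_of_opt G1 G2 b a1 a2 rstar wstar y x1 x2 r w hfeas hopt hlt hsat1 hsat2
  obtain ⟨⟨-, -, f3, f4, f5, f6, f7, f8, f9, f10, f11⟩, f12, f13⟩ := hfeas
  have hrint : ¬ ∃ z : ℤ, r = (z : ℝ) := by
    rintro ⟨z, hz⟩
    have h1 : ((⌊rstar⌋ : ℤ) : ℝ) < z := by linarith
    have h2 : (z : ℝ) < ((⌊rstar⌋ + 1 : ℤ) : ℝ) := by push_cast; linarith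
    have h1' := Int.cast_lt.1 h1
    have h2' := Int.cast_lt.1 h2
    omega
  have hcol : ∀ h, ∑ j, y j h = w := by
    intro h
    have : h ∈ G1 ∪ G2 := by rw [hcover]; exact Finset.mem_univ h
    rcases Finset.mem_union.1 this with hh | hh
    · exact (hsat1 h hh).1
    · exact (hsat2 h hh).1
  have hy : ∀ j h, 0 ≤ y j h := fun j h => (f4 j h).1
  have hw : 0 < w := by
    have h0 : 0 ≤ w := (Finset.sum_nonneg fun h _ => hy j h).trans (f3 j)
    refine lt_of_le_of_ne h0 fun e => hrint ⟨-⌈wstar - rstar⌉, ?_⟩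
    push_cast
    linarith
  have hu : 0 < x1 j := lt_of_le_of_ne (f8 j).1 fun e => by simp [← e] at hj
  have hv : 0 < x2 j := lt_of_le_of_ne (f9 j).1 fun e => by simp [← e] at hj
  have hI1 : ∀ k, (0 < x1 k → ((∑ h ∈ G2, ((b k h : ℝ) - y k h)) + (a1 k : ℝ) - x1 k
      = (∑ j', (a1 j' : ℝ)) - r) ∧ ∑ h ∈ G2, y k h = w) → ∃ z : ℤ, x1 k = (z : ℝ) := by
    intro k hk
    rcases (f8 k).1.eq_or_lt with e | e
    · exact ⟨0, by simp [← e]⟩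
    · exact int_of_tight G2 (b k) (a1 k) (∑ j', a1 j') (y k) (x1 k) r w _ f12
        (by push_cast; exact hk e)
  have hI2 : ∀ k, (0 < x2 k → ((∑ h ∈ G1, ((b k h : ℝ) - y k h)) + (a2 k : ℝ) - x2 k
      = (∑ j', (a2 j' : ℝ)) - r) ∧ ∑ h ∈ G1, y k h = w) → ∃ z : ℤ, x2 k = (z : ℝ) := by
    intro k hk
    rcases (f9 k).1.eq_or_lt with e | e
    · exact ⟨0, by simp [← e]⟩
    · exact int_of_tight G1 (b k) (a2 k) (∑ j', a2 j') (y k) (x2 k) r w _ f12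
        (by push_cast; exact hk e)
  by_cases htight : ∃ i, i ≠ j ∧ x1 i + x2 i = r
  · exfalso
    obtain ⟨i, hij, hi⟩ := htight
    have hle1 : x1 i + x1 j ≤ r := by
      rw [← f5, ← Finset.sum_pair hij]
      exact Finset.sum_le_sum_of_subset_of_nonneg (Finset.subset_univ _) fun t _ _ => (f8 t).1
    have hle2 : x2 i + x2 j ≤ r := by
      rw [← f6, ← Finset.sum_pair hij]
      exact Finset.sum_le_sum_of_subset_of_nonneg (Finset.subset_univ _) fun t _ _ => (f9 t).1
    have hui : 0 < x1 i := by linarith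
    have hvi : 0 < x2 i := by linarith
    have ht : ∀ t, t ≠ i → x1 t + x2 t = r → ∀ k, k ≠ i → (0 < x1 k ∨ 0 < x2 k) → t = k := by
      intro t hti htr k hki hk
      by_contra htk
      have hs : (x1 i + x2 i) + ((x1 t + x2 t) + (x1 k + x2 k)) ≤ r + r := by
        have e : ∑ s ∈ ({i, t, k} : Finset J), (x1 s + x2 s) ≤ ∑ s, (x1 s + x2 s) :=
          Finset.sum_le_sum_of_subset_of_nonneg (Finset.subset_univ _)
            fun s _ _ => add_nonneg (f8 s).1 (f9 s).1
        rw [Finset.sum_add_distrib (s := Finset.univ), f5, f6,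
          Finset.sum_insert (by simp [Ne.symm hti, Ne.symm hki]), Finset.sum_pair htk] at e
        exact e
      have := (f8 k).1
      have := (f9 k).1
      rcases hk with hk | hk <;> linarith
    rcases dichotomy hdisj H hw hy hcol f3 i hui hvi ht with h | h
    · have h' := center_too hdisj H hw hy hcol f3 i j hij.symm hui hu hv ht h
      obtain ⟨z, hz⟩ := int_sum x1 fun k => hI1 k (h' k)
      exact hrint ⟨z, by rw [← f5, hz]⟩
    · have h' := center_too hdisj.symm H.swap hw hy hcol f3 i j hij.symm hvi hv hu
        (fun t a1 a2 k a3 a4 => ht t a1 (by rw [add_comm]; exact a2) k a3 a4.symm) h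
      obtain ⟨z, hz⟩ := int_sum x2 fun k => hI2 k (h' k)
      exact hrint ⟨z, by rw [← f6, hz]⟩
  · have ht : ∀ t, t ≠ j → x1 t + x2 t = r → ∀ k, k ≠ j → (0 < x1 k ∨ 0 < x2 k) → t = k :=
      fun t h1 h2 => absurd ⟨t, h1, h2⟩ htight
    have hfin : ∀ (x : J → ℝ) (B : Finset J), (∀ j, j ∈ B ↔ ¬∃ z : ℤ, x j = (z : ℝ)) →
        ∑ j, x j = r → (∀ k, k ≠ j → ∃ z : ℤ, x k = (z : ℝ)) → B = {j} := by
      intro x B hB hs hx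
      have hjB : j ∈ B := by
        rw [hB]
        intro hz
        obtain ⟨z, hz⟩ := int_sum x fun k => by
          by_cases e : k = j
          · rw [e]; exact hz
          · exact hx k e
        exact hrint ⟨z, by rw [← hs, hz]⟩
      ext k
      rw [Finset.mem_singleton]
      constructor
      · intro hk
        by_contra e
        exact (hB k).1 hk (hx k e)
      · rintro rfl
        exact hjB
    rcases dichotomy hdisj H hw hy hcol f3 j hu hv ht with h | h
    · exact Or.inl (hfin x1 B1 hB1 f5 fun k hk => hI1 k (h k hk))
    · exact Or.inr (hfin x2 B2 hB2 f6 fun k hk => hI2 k (h k hk))
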